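/- Let M = (m_ij) ∈ ℤ^{d×d} satisfy m_ii = 0, m_ik ≤ m_ij + m_jk for all i, j, k, and be in standard form (m_ij ≥ 0 for all i, j and m_ij + m_ji > 0 for i ≠ j), and let N ∈ ℤ^{d×d} satisfy n_ik ≤ n_ij + m_jk and n_ik ≤ m_ij + n_jk for all i, j, k. Then the pseudo-inverse of the fractional ideal I_N satisfies (Λ_M : I_N) = {X ∈ K^{d×d} : X·I_N ⊆ Λ_M and I_N·X ⊆ Λ_M} = I_{N'}, where n'_ij = max_{1≤ℓ≤d} max(m_{ℓj} − n_{ℓi}, m_{iℓ} − n_{jℓ}) for all 1 ≤ i, j ≤ d. -/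

import Mathlib

set_option synthInstance.maxHeartbeats 400000
set_option maxHeartbeats 1600000

open scoped Pointwise

/-- The set `I_N = {X ∈ K^{d×d} : val(X) ≥ N}` (equal to `Λ_N` for suitable `N`). -/
def matSet {K : Type*} [Field K] (v : AddValuation K (WithTop ℤ)) {d : ℕ}
    (N : Matrix (Fin d) (Fin d) ℤ) : Set (Matrix (Fin d) (Fin d) K) :=
  {X | ∀ i j, (N i j : WithTop ℤ) ≤ v (X i j)}

theorem WithTop.coe_int_sub_le_iff (m n : ℤ) (a : WithTop ℤ) :
    ((m - n : ℤ) : WithTop ℤ) ≤ a ↔ (m : WithTop ℤ) ≤ a + (n : WithTop ℤ) := by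
  induction a with
  | top => simp
  | coe a =>
    rw [← WithTop.coe_add, WithTop.coe_le_coe, WithTop.coe_le_coe]
    exact sub_le_iff_le_add

theorem single_mem_matSet {K : Type*} [Field K] (v : AddValuation K (WithTop ℤ)) {d : ℕ}
    (N : Matrix (Fin d) (Fin d) ℤ) (a b : Fin d) {y : K} (hy : v y = (N a b : WithTop ℤ)) :
    Matrix.single a b y ∈ matSet v N := by
  intro i j
  by_cases h : a = i ∧ b = j
  · obtain ⟨rfl, rfl⟩ := h
    simp [hy]
  · simp [Matrix.single_apply_of_ne _ _ _ _ _ h]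

theorem mul_mem_matSet {K : Type*} [Field K] (v : AddValuation K (WithTop ℤ)) {d : ℕ}
    {A B C : Matrix (Fin d) (Fin d) ℤ} (h : ∀ i j k, C i k ≤ A i j + B j k)
    {X Y : Matrix (Fin d) (Fin d) K} (hX : X ∈ matSet v A) (hY : Y ∈ matSet v B) :
    X * Y ∈ matSet v C := by
  intro i k
  rw [Matrix.mul_apply]
  refine AddValuation.map_le_sum v fun j _ => ?_
  rw [AddValuation.map_mul]
  exact (WithTop.coe_le_coe.2 (h i j k)).trans
    ((WithTop.coe_add _ _).trans_le (add_le_add (hX i j) (hY j k)))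

/-- For a graduated order `Λ_M` in standard form and a fractional-ideal
matrix `N`, the pseudo-inverse of `I_N` is `I_{N'}` where
`n'_ij = max_ℓ max(m_ℓj - n_ℓi, m_iℓ - n_jℓ)`. -/
theorem pseudo_inverse_formula {K : Type*} [Field K]
    (v : AddValuation K (WithTop ℤ)) (hv : Function.Surjective v)
    (d : ℕ) (hd : 0 < d)
    (M : Matrix (Fin d) (Fin d) ℤ) (hdiag : ∀ i, M i i = 0)
    (htri : ∀ i j k, M i k ≤ M i j + M j k)
    (hstd1 : ∀ i j, 0 ≤ M i j) (hstd2 : ∀ i j, i ≠ j → 0 < M i j + M j i)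
    (N N' : Matrix (Fin d) (Fin d) ℤ)
    (hN : ∀ i j k, N i k ≤ N i j + M j k ∧ N i k ≤ M i j + N j k)
    (hN' : ∀ i j, (∀ l, M l j - N l i ≤ N' i j ∧ M i l - N j l ≤ N' i j) ∧
        ∃ l, N' i j = M l j - N l i ∨ N' i j = M i l - N j l) :
    {X : Matrix (Fin d) (Fin d) K |
        (∀ Y ∈ matSet v N, X * Y ∈ matSet v M) ∧ ∀ Y ∈ matSet v N, Y * X ∈ matSet v M}
      = matSet v N' := by
  ext X
  constructor
  · rintro ⟨hl, hr⟩ i j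
    obtain ⟨-, l, h | h⟩ := hN' i j
    · obtain ⟨y, hy⟩ := hv (N l i : WithTop ℤ)
      have key := hr _ (single_mem_matSet v N l i hy) l j
      rw [Matrix.single_mul_apply_same, AddValuation.map_mul, hy, add_comm] at key
      rwa [h, WithTop.coe_int_sub_le_iff]
    · obtain ⟨y, hy⟩ := hv (N j l : WithTop ℤ)
      have key := hl _ (single_mem_matSet v N j l hy) i l
      rw [Matrix.mul_single_apply_same, AddValuation.map_mul, hy] at key
      rwa [h, WithTop.coe_int_sub_le_iff]
  · intro hX
    refine ⟨fun Y hY => mul_mem_matSet v (fun i j k => ?_) hX hY,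
      fun Y hY => mul_mem_matSet v (fun i j k => ?_) hY hX⟩
    · linarith [((hN' i j).1 k).2]
    · linarith [((hN' j k).1 i).1]
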